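/- (Uniqueness of trade functions) Let ρ_1, …, ρ_N be expressive, strictly risk averse convex risk measures on ℝ^k and S ⊆ {1,…,N}. If f and g are both trade functions on S, then for every r ∈ (ℝ^k)^N there exist reals (c_i)_{i∈S} with Σ_{i∈S} c_i = 0 such that g(r)_i = f(r)_i + c_i · r^$ for all i ∈ S; that is, trade functions on S are unique up to zero-sum cash transfers. -/

import Mathlib

open scoped RealInnerProductSpace

/-- A (normalized) convex monetary risk measure on positions `r ∈ ℝ^k`, where the
position `r` pays `⟨r, φ(ω)⟩` on outcome `ω` and `rcash` is the riskless bundle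
paying `1` on every outcome. -/
structure IsConvexRiskMeasure {k : ℕ} {Ω : Type*} [Fintype Ω]
    (φ : Ω → EuclideanSpace ℝ (Fin k)) (rcash : EuclideanSpace ℝ (Fin k))
    (ρ : EuclideanSpace ℝ (Fin k) → ℝ) : Prop where
  monotone : ∀ r r' : EuclideanSpace ℝ (Fin k),
    (∀ ω, ⟪r, φ ω⟫ ≤ ⟪r', φ ω⟫) → ρ r' ≤ ρ r
  cash_invariant : ∀ (r : EuclideanSpace ℝ (Fin k)) (c : ℝ), ρ (r + c • rcash) = ρ r - c
  convex : ConvexOn ℝ Set.univ ρ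
  normalized : ρ 0 = 0

/-- `ρ` is expressive: everywhere differentiable, with gradient range dense in `−Π`,
where `Π = conv(φ(Ω))`. -/
def Expressive {k : ℕ} {Ω : Type*} [Fintype Ω]
    (φ : Ω → EuclideanSpace ℝ (Fin k)) (ρ : EuclideanSpace ℝ (Fin k) → ℝ) : Prop :=
  (∀ x, DifferentiableAt ℝ ρ x) ∧
    closure (Set.range fun x => gradient ρ x) =
      (fun π => -π) '' convexHull ℝ (Set.range φ)

/-- `ρ` is strictly risk averse: the convexity inequality is strict unless the
difference of the two positions is a multiple of the riskless bundle `rcash`. -/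
def StrictlyRiskAverse {k : ℕ} (rcash : EuclideanSpace ℝ (Fin k))
    (ρ : EuclideanSpace ℝ (Fin k) → ℝ) : Prop :=
  ∀ r r' : EuclideanSpace ℝ (Fin k), ∀ t : ℝ, t ∈ Set.Ioo (0 : ℝ) 1 →
    (∀ c : ℝ, r - r' ≠ c • rcash) →
      ρ (t • r + (1 - t) • r') < t * ρ r + (1 - t) * ρ r'

/-- The infimal convolution `(∧_{i∈S} ρ_i)(r) = inf {Σ_{i∈S} ρ_i(r_i) : Σ_{i∈S} r_i = r}`
of the risk measures indexed by `S`. -/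
noncomputable def wedgeRisk {k N : ℕ} (S : Finset (Fin N))
    (ρ : Fin N → EuclideanSpace ℝ (Fin k) → ℝ) (r : EuclideanSpace ℝ (Fin k)) : ℝ :=
  sInf {s : ℝ | ∃ rs : Fin N → EuclideanSpace ℝ (Fin k),
    (∑ i ∈ S, rs i) = r ∧ s = ∑ i ∈ S, ρ i (rs i)}

/-- The `S`-surplus `Φ_S(r_S) = Σ_{i∈S} ρ_i(r_i) − (∧_{i∈S} ρ_i)(Σ_{i∈S} r_i)`. -/
noncomputable def surplus {k N : ℕ} (S : Finset (Fin N))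
    (ρ : Fin N → EuclideanSpace ℝ (Fin k) → ℝ)
    (r : Fin N → EuclideanSpace ℝ (Fin k)) : ℝ :=
  (∑ i ∈ S, ρ i (r i)) - wedgeRisk S ρ (∑ i ∈ S, r i)

/-- A trade function on `S`: it preserves the total position of `S`, allocates the whole
`S`-surplus, and leaves agents outside `S` untouched. -/
def IsTradeFunction {k N : ℕ} (S : Finset (Fin N))
    (ρ : Fin N → EuclideanSpace ℝ (Fin k) → ℝ)
    (f : (Fin N → EuclideanSpace ℝ (Fin k)) → Fin N → EuclideanSpace ℝ (Fin k)) : Prop :=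
  ∀ r, (∑ i ∈ S, f r i) = (∑ i ∈ S, r i) ∧ surplus S ρ (f r) = 0 ∧
    ∀ j ∉ S, f r j = r j

section ConvexGradient

variable {E : Type*} [NormedAddCommGroup E] [InnerProductSpace ℝ E] [CompleteSpace E]

/-- A differentiable convex function lies above its tangent hyperplanes. -/
theorem ConvexOn.add_inner_gradient_le {ρ : E → ℝ} (hρ : ConvexOn ℝ Set.univ ρ) {z : E}
    (hz : DifferentiableAt ℝ ρ z) (x : E) : ρ z + ⟪gradient ρ z, x - z⟫ ≤ ρ x := by
  have hline : ConvexOn ℝ Set.univ (ρ ∘ AffineMap.lineMap (k := ℝ) z x) := by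
    simpa using hρ.comp_affineMap (AffineMap.lineMap (k := ℝ) z x)
  have hderiv : HasDerivAt (ρ ∘ AffineMap.lineMap (k := ℝ) z x) ⟪gradient ρ z, x - z⟫ 0 := by
    have hgrad := hz.hasGradientAt.hasFDerivAt
    have hgrad' : HasFDerivAt ρ (InnerProductSpace.toDual ℝ E (gradient ρ z))
        (AffineMap.lineMap (k := ℝ) z x (0 : ℝ)) := by
      simpa using hgrad
    simpa using hgrad'.comp_hasDerivAt (0 : ℝ) AffineMap.hasDerivAt_lineMap
  have hslope := hline.le_slope_of_hasDerivAt (Set.mem_univ 0) (Set.mem_univ 1) one_pos hderiv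
  simp only [slope_def_field, Function.comp_apply, AffineMap.lineMap_apply_zero,
    AffineMap.lineMap_apply_one, sub_zero, div_one] at hslope
  linarith

end ConvexGradient

section AffineMinorants

variable {E : Type*} [NormedAddCommGroup E] [InnerProductSpace ℝ E]
  {Ω : Type*} [Fintype Ω] [Nonempty Ω]

/-- The barycenter of a finite family. -/
noncomputable def barycenter (φ : Ω → E) : E := (Fintype.card Ω : ℝ)⁻¹ • ∑ ω, φ ω

theorem sum_inner_sub_barycenter (φ : Ω → E) (y : E) :
    ∑ ω, ⟪φ ω - barycenter φ, y⟫ = 0 := by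
  have hcard : (Fintype.card Ω : ℝ) ≠ 0 := by simp
  rw [← sum_inner, Finset.sum_sub_distrib]
  simp [barycenter, ← Nat.cast_smul_eq_nsmul ℝ, smul_smul, hcard]

theorem inner_barycenter_eq_one {φ : Ω → E} {u : E} (hu : ∀ ω, ⟪u, φ ω⟫ = 1) :
    ⟪u, barycenter φ⟫ = 1 := by
  simp [barycenter, inner_smul_right, inner_sum, hu]

theorem norm_le_card_mul_of_sum_eq_zero {a : Ω → ℝ} (ha : ∑ ω, a ω = 0) {c : ℝ}
    (hc : 0 ≤ c) (hac : ∀ ω, a ω ≤ c) : ‖a‖ ≤ Fintype.card Ω * c := by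
  have hcard : (1 : ℝ) ≤ Fintype.card Ω := by exact_mod_cast Fintype.card_pos (α := Ω)
  rw [pi_norm_le_iff_of_nonneg (by positivity)]
  intro ω
  have hsum : c - a ω ≤ ∑ ω', (c - a ω') :=
    Finset.single_le_sum (f := fun ω' => c - a ω')
      (fun ω' _ => sub_nonneg.2 (hac ω')) (Finset.mem_univ ω)
  simp [Finset.sum_sub_distrib, ha] at hsum
  rw [Real.norm_eq_abs, abs_le]
  constructor <;> nlinarith [hac ω]

variable [FiniteDimensional ℝ E]

/-- The barycenter is in the relative interior of the convex hull: in every direction of the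
hyperplane orthogonal to `u`, some point of the family is quantitatively further away. -/
theorem exists_pos_forall_mul_norm_le_inner_sub_barycenter {φ : Ω → E} {u : E}
    (hspan : Submodule.span ℝ (Set.range φ) = ⊤) (hu : ∀ ω, ⟪u, φ ω⟫ = 1) :
    ∃ δ > 0, ∀ y, ⟪u, y⟫ = 0 → ∃ ω, δ * ‖y‖ ≤ ⟪φ ω - barycenter φ, y⟫ := by
  let B : E →ₗ[ℝ] (Ω → ℝ) × ℝ :=
    (LinearMap.pi fun ω => innerₗ E (φ ω - barycenter φ)).prod (innerₗ E u)
  have hB : LinearMap.ker B = ⊥ := by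
    rw [LinearMap.ker_eq_bot']
    intro y hy
    have hy₁ (ω : Ω) : ⟪φ ω, y⟫ = ⟪barycenter φ, y⟫ := by
      have h := congrFun (congrArg Prod.fst hy) ω
      simpa [B, inner_sub_left, sub_eq_zero] using h
    have hy₂ : ⟪u, y⟫ = 0 := by simpa [B] using congrArg Prod.snd hy
    have hperp : y - ⟪barycenter φ, y⟫ • u = 0 := by
      have hmem : y - ⟪barycenter φ, y⟫ • u ∈ (Submodule.span ℝ (Set.range φ))ᗮ := by
        rw [Submodule.mem_orthogonal]
        intro v hv
        induction hv using Submodule.span_induction with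
        | mem v hv =>
          obtain ⟨ω, rfl⟩ := hv
          rw [inner_sub_right, inner_smul_right, real_inner_comm u, hu, hy₁]
          ring
        | zero => simp
        | add v w _ _ hv hw => rw [inner_add_left, hv, hw, add_zero]
        | smul t v _ hv => rw [inner_smul_left, hv, mul_zero]
      simpa [hspan] using hmem
    have hself : ⟪y, y⟫ = 0 := by
      nth_rewrite 1 [sub_eq_zero.1 hperp]
      rw [inner_smul_left, hy₂, mul_zero]
    exact inner_self_eq_zero.1 hself
  obtain ⟨K, hK, hanti⟩ := B.exists_antilipschitzWith hB
  have hK' : (0 : ℝ) < K := hK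
  have hcard : (0 : ℝ) < Fintype.card Ω := by exact_mod_cast Fintype.card_pos (α := Ω)
  refine ⟨(2 * (K : ℝ) * Fintype.card Ω)⁻¹, by positivity, fun y hy => ?_⟩
  by_contra! hlt
  have hbound : ‖B y‖ ≤ Fintype.card Ω * ((2 * (K : ℝ) * Fintype.card Ω)⁻¹ * ‖y‖) := by
    rw [Prod.norm_def]
    refine max_le ?_ ?_
    · exact norm_le_card_mul_of_sum_eq_zero (sum_inner_sub_barycenter φ y) (by positivity)
        fun ω => (hlt ω).le
    · have hB₂ : (B y).2 = 0 := hy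
      rw [hB₂, norm_zero]
      positivity
  have hle : ‖y‖ ≤ K * ‖B y‖ := by simpa using hanti.le_mul_dist y 0
  have hhalf : ‖y‖ ≤ ‖y‖ / 2 := calc
    ‖y‖ ≤ K * (Fintype.card Ω * ((2 * (K : ℝ) * Fintype.card Ω)⁻¹ * ‖y‖)) :=
      hle.trans (mul_le_mul_of_nonneg_left hbound hK'.le)
    _ = ‖y‖ / 2 := by field_simp
  have hy0 : y = 0 := norm_le_zero_iff.1 (by linarith)
  obtain ⟨ω⟩ := ‹Nonempty Ω›
  simpa [hy0] using hlt ω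

/-- A differentiable convex function whose gradients are dense in the opposite of the convex hull
of `φ` has an affine minorant whose slope is the opposite of the barycenter of `φ`. -/
theorem exists_forall_inner_neg_barycenter_sub_le {φ : Ω → E} {u : E}
    (hspan : Submodule.span ℝ (Set.range φ) = ⊤) (hu : ∀ ω, ⟪u, φ ω⟫ = 1)
    {ρ : E → ℝ} (hρ : ConvexOn ℝ Set.univ ρ) (hd : Differentiable ℝ ρ)
    (hclosure : closure (Set.range fun x => gradient ρ x) =
      (fun π => -π) '' convexHull ℝ (Set.range φ)) :
    ∃ C : ℝ, ∀ x, ⟪-barycenter φ, x⟫ - C ≤ ρ x := by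
  obtain ⟨δ, hδ, hinner⟩ := exists_pos_forall_mul_norm_le_inner_sub_barycenter hspan hu
  have hgrad_u (z : E) : ⟪gradient ρ z, u⟫ = -1 := by
    have hz := subset_closure (Set.mem_range_self (f := fun x => gradient ρ x) z)
    rw [hclosure] at hz
    obtain ⟨π, hπ, hπz⟩ := hz
    have hhull : convexHull ℝ (Set.range φ) ⊆ {x | innerₗ E u x = 1} :=
      convexHull_min (by rintro _ ⟨ω, rfl⟩; simpa using hu ω)
        (convex_hyperplane (innerₗ E u).isLinear 1)
    have hπu : ⟪u, π⟫ = 1 := by simpa using hhull hπ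
    rw [← hπz, inner_neg_left, real_inner_comm, hπu]
  have happrox (ω : Ω) : ∃ z, dist (-φ ω) (gradient ρ z) < δ := by
    have hω : -φ ω ∈ closure (Set.range fun x => gradient ρ x) := by
      rw [hclosure]
      exact ⟨φ ω, subset_convexHull ℝ _ (Set.mem_range_self ω), rfl⟩
    obtain ⟨_, ⟨z, rfl⟩, hz⟩ := Metric.mem_closure_iff.1 hω δ hδ
    exact ⟨z, hz⟩
  choose z hz using happrox
  refine ⟨∑ ω, |⟪gradient ρ (z ω), z ω⟫ - ρ (z ω)|, fun x => ?_⟩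
  set t : ℝ := ⟪u, x⟫ / ⟪u, u⟫ with ht
  have huy : ⟪u, x - t • u⟫ = 0 := by
    rcases eq_or_ne u 0 with rfl | hu0
    · simp
    · have : ⟪u, u⟫ ≠ 0 := inner_self_ne_zero.2 hu0
      rw [inner_sub_right, inner_smul_right, ht]
      field_simp
      ring
  obtain ⟨ω, hω⟩ := hinner (-(x - t • u)) (by rw [inner_neg_right, huy, neg_zero])
  have hcs : -⟪gradient ρ (z ω) + φ ω, x - t • u⟫ ≤ δ * ‖x - t • u‖ := by
    have hdist : ‖gradient ρ (z ω) + φ ω‖ ≤ δ := by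
      have h := (hz ω).le
      rwa [dist_comm, dist_eq_norm, sub_neg_eq_add] at h
    exact (neg_le_abs _).trans ((abs_real_inner_le_norm _ _).trans
      (mul_le_mul_of_nonneg_right hdist (norm_nonneg _)))
  have hgap : ⟪-barycenter φ, x - t • u⟫ ≤ ⟪gradient ρ (z ω), x - t • u⟫ := by
    rw [norm_neg, inner_neg_right, inner_sub_left] at hω
    rw [inner_add_left] at hcs
    rw [inner_neg_left]
    linarith
  have hslope : ⟪-barycenter φ, x⟫ ≤ ⟪gradient ρ (z ω), x⟫ := by
    simp only [inner_sub_right, inner_smul_right, hgrad_u, inner_neg_left] at hgap ⊢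
    rw [real_inner_comm u, inner_barycenter_eq_one hu] at hgap
    linarith
  have htangent := hρ.add_inner_gradient_le (hd (z ω)) x
  rw [inner_sub_right] at htangent
  have hsingle : |⟪gradient ρ (z ω), z ω⟫ - ρ (z ω)| ≤
      ∑ ω, |⟪gradient ρ (z ω), z ω⟫ - ρ (z ω)| :=
    Finset.single_le_sum (f := fun ω => |⟪gradient ρ (z ω), z ω⟫ - ρ (z ω)|)
      (fun _ _ => abs_nonneg _) (Finset.mem_univ ω)
  linarith [le_abs_self (⟪gradient ρ (z ω), z ω⟫ - ρ (z ω))]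

end AffineMinorants

/-- If the risk measures admit affine minorants with a common slope, the infimal convolution is
bounded below by the total risk of any allocation. -/
theorem wedgeRisk_le_of_common_slope {k N : ℕ} {S : Finset (Fin N)}
    {ρ : Fin N → EuclideanSpace ℝ (Fin k) → ℝ} {p : EuclideanSpace ℝ (Fin k)}
    (hp : ∀ i, ∃ C : ℝ, ∀ x, ⟪p, x⟫ - C ≤ ρ i x) (rs : Fin N → EuclideanSpace ℝ (Fin k)) :
    wedgeRisk S ρ (∑ i ∈ S, rs i) ≤ ∑ i ∈ S, ρ i (rs i) := by
  choose C hC using hp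
  refine csInf_le ⟨⟪p, ∑ i ∈ S, rs i⟫ - ∑ i ∈ S, C i, ?_⟩ ⟨rs, rfl, rfl⟩
  rintro _ ⟨rs', hrs', rfl⟩
  rw [← hrs', inner_sum, ← Finset.sum_sub_distrib]
  exact Finset.sum_le_sum fun i _ => hC i _

/-- Two optimal allocations of the same total position differ by cash transfers. -/
theorem exists_smul_eq_sub_of_surplus_eq_zero {k N : ℕ} {S : Finset (Fin N)}
    {rcash : EuclideanSpace ℝ (Fin k)} {ρ : Fin N → EuclideanSpace ℝ (Fin k) → ℝ}
    (hconvex : ∀ i, ConvexOn ℝ Set.univ (ρ i)) (hstrict : ∀ i, StrictlyRiskAverse rcash (ρ i))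
    (hwedge : ∀ rs : Fin N → EuclideanSpace ℝ (Fin k),
      wedgeRisk S ρ (∑ i ∈ S, rs i) ≤ ∑ i ∈ S, ρ i (rs i))
    {a b : Fin N → EuclideanSpace ℝ (Fin k)} (hab : ∑ i ∈ S, a i = ∑ i ∈ S, b i)
    (ha : surplus S ρ a = 0) (hb : surplus S ρ b = 0) {i : Fin N} (hi : i ∈ S) :
    ∃ c : ℝ, a i - b i = c • rcash := by
  by_contra! hne
  have hhalf : (1 / 2 : ℝ) ∈ Set.Ioo (0 : ℝ) 1 := by norm_num
  have hlt : ∑ j ∈ S, ρ j ((1 / 2 : ℝ) • a j + (1 - 1 / 2 : ℝ) • b j) <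
      ∑ j ∈ S, (1 / 2 * ρ j (a j) + (1 - 1 / 2) * ρ j (b j)) :=
    Finset.sum_lt_sum
      (fun j _ => (hconvex j).2 (Set.mem_univ _) (Set.mem_univ _) (by norm_num) (by norm_num)
        (by norm_num))
      ⟨i, hi, hstrict i _ _ _ hhalf hne⟩
  have hmid := hwedge fun j => (1 / 2 : ℝ) • a j + (1 - 1 / 2 : ℝ) • b j
  rw [Finset.sum_add_distrib, ← Finset.smul_sum, ← Finset.smul_sum, hab, ← add_smul,
    add_sub_cancel, one_smul] at hmid
  rw [Finset.sum_add_distrib, ← Finset.mul_sum, ← Finset.mul_sum] at hlt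
  rw [surplus, hab] at ha
  rw [surplus] at hb
  linarith

/-- **Uniqueness of trade functions up to zero-sum cash transfers.**
Let `ρ_1, …, ρ_N` be expressive, strictly risk averse convex risk measures on `ℝ^k`
and `S ⊆ {1,…,N}`. If `f` and `g` are both trade functions on `S`, then for every `r`
there exist reals `(c_i)_{i∈S}` summing to zero with `g(r)_i = f(r)_i + c_i·r^$` for
all `i ∈ S`. -/
theorem trade_functions_unique_up_to_cash {k N : ℕ} {Ω : Type*} [Fintype Ω]
    (φ : Ω → EuclideanSpace ℝ (Fin k)) (rcash : EuclideanSpace ℝ (Fin k))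
    (hspan : Submodule.span ℝ (Set.range φ) = ⊤)
    (hrcash : ∀ ω, ⟪rcash, φ ω⟫ = 1)
    (ρ : Fin N → EuclideanSpace ℝ (Fin k) → ℝ)
    (hrisk : ∀ i, IsConvexRiskMeasure φ rcash (ρ i))
    (hexp : ∀ i, Expressive φ (ρ i))
    (hstrict : ∀ i, StrictlyRiskAverse rcash (ρ i))
    (S : Finset (Fin N))
    (f g : (Fin N → EuclideanSpace ℝ (Fin k)) → Fin N → EuclideanSpace ℝ (Fin k))
    (hf : IsTradeFunction S ρ f) (hg : IsTradeFunction S ρ g) :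
    ∀ r : Fin N → EuclideanSpace ℝ (Fin k),
      ∃ c : Fin N → ℝ, (∑ i ∈ S, c i) = 0 ∧
        ∀ i ∈ S, g r i = f r i + c i • rcash := by
  intro r
  rcases S.eq_empty_or_nonempty with rfl | ⟨i₀, -⟩
  · exact ⟨0, by simp, by simp⟩
  have hΩ : Nonempty Ω := by
    by_contra hempty
    rw [not_nonempty_iff] at hempty
    have hmem := subset_closure (Set.mem_range_self (f := fun x => gradient (ρ i₀) x) 0)
    rw [(hexp i₀).2, Set.range_eq_empty φ] at hmem
    simp at hmem
  have hrcash0 : rcash ≠ 0 := by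
    rintro rfl
    simpa using hrcash hΩ.some
  have hwedge := wedgeRisk_le_of_common_slope (S := S) fun i =>
    exists_forall_inner_neg_barycenter_sub_le hspan hrcash (hrisk i).convex (hexp i).1 (hexp i).2
  have hsum : ∑ i ∈ S, g r i = ∑ i ∈ S, f r i := (hg r).1.trans (hf r).1.symm
  have hcash (i : Fin N) : ∃ c : ℝ, i ∈ S → g r i - f r i = c • rcash := by
    by_cases hi : i ∈ S
    · obtain ⟨c, hc⟩ := exists_smul_eq_sub_of_surplus_eq_zero (fun i => (hrisk i).convex) hstrict
        hwedge hsum (hg r).2.1 (hf r).2.1 hi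
      exact ⟨c, fun _ => hc⟩
    · exact ⟨0, fun h => absurd h hi⟩
  choose c hc using hcash
  refine ⟨c, ?_, fun i hi => by rw [← hc i hi]; abel⟩
  have hzero : (∑ i ∈ S, c i) • rcash = 0 := by
    rw [Finset.sum_smul, ← Finset.sum_congr rfl hc, Finset.sum_sub_distrib, hsum, sub_self]
  exact (smul_eq_zero.1 hzero).resolve_right hrcash0
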